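/- There exist positive measures σ and σ' on [0,∞) such that for all real s > 0: ∫₀¹ t^s dμ(t) = ∫₀^∞ dσ(x)/(x+s) and f(s)/s = ∫₀^∞ dσ'(x)/(x+s), where f is the Bernstein transform of μ; that is, the Mellin transform F of μ and f(z)/z are Stieltjes transforms. -/

import Mathlib

open MeasureTheory Set

/-- The fixed point sequence. -/
noncomputable def fpSeq : ℕ → ℝ
  | 0 => 1
  | n + 1 => (-1 + Real.sqrt (1 + 4 * fpSeq n ^ 2)) / (2 * fpSeq n)

/-- The integrand `(1 - t^s)/(1 - t)`, extended continuously by the value `s` at `t = 1`. -/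
noncomputable def bernKernelReal (s : ℝ) (t : ℝ) : ℝ :=
  if t = 1 then s else (1 - t ^ s) / (1 - t)

/-- The Bernstein transform of `μ`, restricted to real arguments. -/
noncomputable def bernTransformReal (μ : Measure ℝ) (s : ℝ) : ℝ :=
  ∫ t in Set.Icc (0:ℝ) 1, bernKernelReal s t ∂μ

open Filter Topology

/-- The map `w ↦ w - 1/w`, which sends `1 / fpSeq (n + 1)` to `1 / fpSeq n`. -/
noncomputable def subInv (w : ℝ) : ℝ := w - w⁻¹

theorem subInv_sub_subInv {a b : ℝ} (ha : 0 < a) (hb : 0 < b) :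
    subInv a - subInv b = (a - b) * (1 + (a * b)⁻¹) := by
  unfold subInv
  field_simp
  ring

theorem subInv_strictMonoOn : StrictMonoOn subInv (Ioi 0) := by
  intro a ha b hb hab
  have h := subInv_sub_subInv (a := b) (b := a) hb ha
  have hpos : 0 < (b - a) * (1 + (b * a)⁻¹) := by
    have : 0 < b - a := sub_pos.2 hab
    have ha' : 0 < a := ha
    have hb' : 0 < b := hb
    positivity
  linarith

theorem fpSeq_pos (n : ℕ) : 0 < fpSeq n := by
  induction n with
  | zero => simp [fpSeq]
  | succ n ih =>
    rw [fpSeq]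
    refine div_pos ?_ (by positivity)
    have : (1 : ℝ) < Real.sqrt (1 + 4 * fpSeq n ^ 2) := by
      rw [Real.lt_sqrt (by norm_num)]
      nlinarith [pow_pos ih 2]
    linarith

theorem fpSeq_eq_succ (n : ℕ) :
    fpSeq n = fpSeq (n + 1) * (1 + fpSeq n * fpSeq (n + 1)) := by
  have hm := fpSeq_pos n
  have hs : Real.sqrt (1 + 4 * fpSeq n ^ 2) ^ 2 = 1 + 4 * fpSeq n ^ 2 :=
    Real.sq_sqrt (by positivity)
  rw [show fpSeq (n + 1) = (-1 + Real.sqrt (1 + 4 * fpSeq n ^ 2)) / (2 * fpSeq n) from rfl]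
  generalize Real.sqrt (1 + 4 * fpSeq n ^ 2) = r at hs ⊢
  field_simp
  linarith

theorem inv_fpSeq_succ (n : ℕ) : (fpSeq (n + 1))⁻¹ = (fpSeq n)⁻¹ + fpSeq (n + 1) := by
  have h := fpSeq_eq_succ n
  have h0 := fpSeq_pos n
  have h1 := fpSeq_pos (n + 1)
  field_simp
  linarith

theorem subInv_inv_fpSeq_succ (n : ℕ) : subInv (fpSeq (n + 1))⁻¹ = (fpSeq n)⁻¹ := by
  rw [subInv, inv_inv, inv_fpSeq_succ]
  ring

theorem fpSeq_antitone : Antitone fpSeq := by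
  refine antitone_nat_of_succ_le fun n => ?_
  have h := fpSeq_eq_succ n
  nlinarith [mul_pos (fpSeq_pos n) (pow_pos (fpSeq_pos (n + 1)) 2)]

theorem tendsto_fpSeq : Tendsto fpSeq atTop (𝓝 0) := by
  have hbdd : BddBelow (range fpSeq) := ⟨0, by rintro _ ⟨n, rfl⟩; exact (fpSeq_pos n).le⟩
  have hL := tendsto_atTop_ciInf fpSeq_antitone hbdd
  set L := ⨅ n, fpSeq n
  have hL' := hL.comp (tendsto_add_atTop_nat 1)
  have h := tendsto_nhds_unique hL
    ((hL'.mul ((hL.mul hL').const_add 1)).congr fun n => (fpSeq_eq_succ n).symm)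
  have : L = 0 := by
    have : L ^ 3 = 0 := by linarith
    exact pow_eq_zero_iff (by norm_num) |>.1 this
  rwa [this] at hL

theorem tendsto_fpSeq_add_div (k : ℕ) :
    Tendsto (fun n => fpSeq (n + k) / fpSeq n) atTop (𝓝 1) := by
  induction k with
  | zero => simp [div_self (fpSeq_pos _).ne']
  | succ k ih =>
    have hstep : Tendsto (fun n => (1 + fpSeq n * fpSeq (n + 1))⁻¹) atTop (𝓝 1) := by
      simpa using ((tendsto_fpSeq.mul (tendsto_fpSeq.comp (tendsto_add_atTop_nat 1))).const_add
        1).inv₀ (by norm_num)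
    have h := ih.mul (hstep.comp (tendsto_add_atTop_nat k))
    rw [one_mul] at h
    refine h.congr fun n => ?_
    have h1 := fpSeq_pos n
    have h2 := fpSeq_pos (n + k)
    have h3 := fpSeq_pos (n + k + 1)
    have h4 := fpSeq_eq_succ (n + k)
    simp only [Function.comp, ← add_assoc]
    field_simp
    linarith

theorem inv_fpSeq_add_le (n k : ℕ) :
    (fpSeq (n + k))⁻¹ ≤ (fpSeq n)⁻¹ + k * fpSeq n := by
  induction k with
  | zero => simp
  | succ k ih =>
    rw [← add_assoc, inv_fpSeq_succ]
    have := fpSeq_antitone (show n ≤ n + k + 1 by omega)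
    push_cast
    linarith

theorem le_inv_fpSeq_add (n k : ℕ) :
    (fpSeq n)⁻¹ + k * fpSeq (n + k) ≤ (fpSeq (n + k))⁻¹ := by
  induction k with
  | zero => simp
  | succ k ih =>
    rw [← add_assoc, inv_fpSeq_succ (n + k)]
    have := fpSeq_antitone (show n + k ≤ n + k + 1 by omega)
    have : (k : ℝ) * fpSeq (n + k + 1) ≤ k * fpSeq (n + k) := by gcongr
    push_cast
    linarith

theorem iterate_subInv_bounds (k n : ℕ) {x : ℝ} (hx : (fpSeq (n + k))⁻¹ ≤ x) :
    (fpSeq k)⁻¹ ≤ subInv^[n] x ∧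
      subInv^[n] x ≤ (fpSeq k)⁻¹ + (x - (fpSeq (n + k))⁻¹) / fpSeq n := by
  induction n generalizing x with
  | zero => simpa [fpSeq] using hx
  | succ n ih =>
    rw [Function.iterate_succ_apply]
    rw [show n + 1 + k = n + k + 1 by omega] at hx ⊢
    have h1 := fpSeq_pos (n + k + 1)
    have hS : 0 < (fpSeq (n + k + 1))⁻¹ := inv_pos.2 h1
    have hx0 : 0 < x := hS.trans_le hx
    have hdiff := subInv_sub_subInv hx0 hS
    rw [subInv_inv_fpSeq_succ] at hdiff
    have hxi : x⁻¹ ≤ fpSeq (n + k + 1) := inv_le_of_inv_le₀ h1 hx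
    have hmn : fpSeq (n + k + 1) ≤ fpSeq (n + 1) := fpSeq_antitone (by omega)
    have hm1 := fpSeq_pos (n + 1)
    have hm0 := fpSeq_pos n
    have hfac : 1 + (x * (fpSeq (n + k + 1))⁻¹)⁻¹ ≤ fpSeq n / fpSeq (n + 1) := by
      rw [mul_inv, inv_inv, le_div_iff₀ hm1]
      have hstep := fpSeq_eq_succ n
      have hle : x⁻¹ * fpSeq (n + k + 1) ≤ fpSeq n * fpSeq (n + 1) :=
        mul_le_mul ((hxi.trans hmn).trans (fpSeq_antitone (by omega))) hmn h1.le hm0.le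
      nlinarith
    have hd : 0 ≤ x - (fpSeq (n + k + 1))⁻¹ := sub_nonneg.2 hx
    have hdiff_le := mul_le_mul_of_nonneg_left hfac hd
    have hge : (fpSeq (n + k))⁻¹ ≤ subInv x := by
      have : 0 ≤ (x - (fpSeq (n + k + 1))⁻¹) * (1 + (x * (fpSeq (n + k + 1))⁻¹)⁻¹) := by
        positivity
      linarith
    obtain ⟨hlo, hhi⟩ := ih hge
    refine ⟨hlo, hhi.trans ?_⟩
    refine add_le_add le_rfl ?_
    rw [hdiff, div_le_iff₀ hm0]
    calc _ ≤ _ := hdiff_le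
      _ = _ := by ring

theorem tendsto_inv_iterate_subInv (k : ℕ) :
    Tendsto (fun n => (subInv^[n] ((fpSeq n)⁻¹ + k * fpSeq n))⁻¹) atTop (𝓝 (fpSeq k)) := by
  have hS := inv_pos.2 (fpSeq_pos k)
  suffices Tendsto (fun n => subInv^[n] ((fpSeq n)⁻¹ + k * fpSeq n)) atTop (𝓝 (fpSeq k)⁻¹) by
    simpa using this.inv₀ hS.ne'
  have hup : Tendsto (fun n => (fpSeq k)⁻¹ + k * (1 - fpSeq (n + k) / fpSeq n)) atTop
      (𝓝 (fpSeq k)⁻¹) := by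
    simpa using (((tendsto_fpSeq_add_div k).const_sub 1).const_mul (k : ℝ)).const_add (fpSeq k)⁻¹
  refine tendsto_of_tendsto_of_tendsto_of_le_of_le tendsto_const_nhds hup
    (fun n => (iterate_subInv_bounds k n (inv_fpSeq_add_le n k)).1) fun n => ?_
  refine (iterate_subInv_bounds k n (inv_fpSeq_add_le n k)).2.trans ?_
  have h1 := fpSeq_pos n
  have h2 := le_inv_fpSeq_add n k
  refine add_le_add le_rfl ?_
  rw [div_le_iff₀ h1, mul_assoc, sub_mul, div_mul_cancel₀ _ h1.ne']
  linarith

theorem iterate_subInv_inv_fpSeq (n : ℕ) : subInv^[n] (fpSeq n)⁻¹ = 1 := by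
  induction n with
  | zero => simp [fpSeq]
  | succ n ih => rw [Function.iterate_succ_apply, subInv_inv_fpSeq_succ, ih]

/-- The two branches `b₋ < 0 < b₊` of the inverse of `subInv` at `b`, with the partial fraction
decomposition of the resolvent. -/
theorem exists_partialFraction_subInv {b c : ℝ} (hc : 0 < c) (hb : b ≤ subInv c) :
    ∃ p q β γ : ℝ, 0 ≤ p ∧ 0 ≤ q ∧ β ≤ c ∧ γ ≤ c ∧
      ∀ w, c < w → (subInv w - b)⁻¹ = p / (w - β) + q / (w - γ) := by
  set r := Real.sqrt (b ^ 2 + 4)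
  have hr : r ^ 2 = b ^ 2 + 4 := Real.sq_sqrt (by positivity)
  have hr0 : 0 ≤ r := Real.sqrt_nonneg _
  have hrb : |b| < r := by
    apply abs_lt_of_sq_lt_sq _ hr0
    linarith
  obtain ⟨hb1, hb2⟩ := abs_lt.1 hrb
  have hrpos : 0 < r := by linarith
  set β := (b + r) / 2 with hβ
  have hβ0 : 0 < β := by rw [hβ]; linarith
  have hγ0 : b - β < 0 := by rw [hβ]; linarith
  have hmul : β * (β - b) = 1 := by rw [hβ]; linarith
  have hψ : subInv β = b := by
    unfold subInv
    field_simp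
    linarith
  have hβc : β ≤ c := by
    rw [← hψ] at hb
    exact (subInv_strictMonoOn.le_iff_le hβ0 hc).1 hb
  refine ⟨β / r, (β - b) / r, β, b - β, by positivity,
    div_nonneg (by linarith) hr0, hβc, by linarith, fun w hw => ?_⟩
  have hw0 : 0 < w := hc.trans hw
  have h1 : w - β ≠ 0 := by linarith
  have h2 : w - (b - β) ≠ 0 := by linarith
  have hfac : subInv w - b = (w - β) * (w - (b - β)) / w := by
    unfold subInv
    field_simp
    linarith
  have hrβ : r = 2 * β - b := by rw [hβ]; ring
  rw [hfac, inv_div]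
  clear_value r
  field_simp
  linear_combination w * hrβ

theorem exists_partialFraction_iterate_subInv (n : ℕ) :
    ∃ (ι : Type) (_ : Fintype ι) (α β : ι → ℝ), (∀ i, 0 ≤ α i) ∧
      (∀ i, β i ≤ (fpSeq n)⁻¹ - fpSeq n) ∧
      ∀ w, (fpSeq n)⁻¹ - fpSeq n < w → (subInv^[n] w)⁻¹ = ∑ i, α i / (w - β i) := by
  induction n with
  | zero => exact ⟨Unit, inferInstance, fun _ => 1, fun _ => 0, by simp [fpSeq]⟩
  | succ n ih =>
    obtain ⟨ι, _, α, β, hα, hβ, hsum⟩ := ih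
    have hc := inv_pos.2 (fpSeq_pos n)
    have hψ : subInv (fpSeq n)⁻¹ = (fpSeq n)⁻¹ - fpSeq n := by rw [subInv, inv_inv]
    choose p q x y hp hq hx hy hpq using fun i =>
      exists_partialFraction_subInv hc ((hβ i).trans_eq hψ.symm)
    have hS : (fpSeq (n + 1))⁻¹ - fpSeq (n + 1) = (fpSeq n)⁻¹ := by
      rw [inv_fpSeq_succ]; ring
    rw [hS]
    refine ⟨ι ⊕ ι, inferInstance, Sum.elim (fun i => α i * p i) fun i => α i * q i,
      Sum.elim x y, ?_, ?_, fun w hw => ?_⟩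
    · rintro (i | i)
      · exact mul_nonneg (hα i) (hp i)
      · exact mul_nonneg (hα i) (hq i)
    · rintro (i | i)
      · exact hx i
      · exact hy i
    · rw [Function.iterate_succ_apply, hsum, Fintype.sum_sum_type, ← Finset.sum_add_distrib]
      · refine Finset.sum_congr rfl fun i _ => ?_
        simp only [Sum.elim_inl, Sum.elim_inr]
        rw [div_eq_mul_inv, hpq i w hw]
        ring
      · rw [← hψ]
        exact subInv_strictMonoOn hc (hc.trans hw) hw

theorem exists_probabilityMeasure_inv_iterate_subInv (n : ℕ) :
    ∃ τ : ProbabilityMeasure (Icc (0 : ℝ) 1), ∀ s : ℝ, 0 ≤ s →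
      ∫ u, (1 + s * (u : ℝ))⁻¹ ∂(τ : Measure (Icc (0 : ℝ) 1)) =
        (subInv^[n] ((fpSeq n)⁻¹ + s * fpSeq n))⁻¹ := by
  obtain ⟨ι, _, α, β, hα, hβ, hsum⟩ := exists_partialFraction_iterate_subInv n
  have hm := fpSeq_pos n
  have hd : ∀ i, fpSeq n ≤ (fpSeq n)⁻¹ - β i := fun i => by linarith [hβ i]
  have hd0 : ∀ i, 0 < (fpSeq n)⁻¹ - β i := fun i => hm.trans_le (hd i)
  have hw0 : ∀ i, 0 ≤ α i / ((fpSeq n)⁻¹ - β i) := fun i => div_nonneg (hα i) (hd0 i).le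
  have htot : ∑ i, α i / ((fpSeq n)⁻¹ - β i) = 1 := by
    rw [← hsum _ (by linarith), iterate_subInv_inv_fpSeq, inv_one]
  let pt : ι → Icc (0 : ℝ) 1 := fun i =>
    ⟨fpSeq n / ((fpSeq n)⁻¹ - β i), div_nonneg hm.le (hd0 i).le, (div_le_one (hd0 i)).2 (hd i)⟩
  let τ : Measure (Icc (0 : ℝ) 1) :=
    ∑ i, ENNReal.ofReal (α i / ((fpSeq n)⁻¹ - β i)) • Measure.dirac (pt i)
  have hτ : IsProbabilityMeasure τ := by
    constructor
    simp only [τ, Measure.finsetSum_apply, Measure.smul_apply, measure_univ, smul_eq_mul, mul_one]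
    rw [← ENNReal.ofReal_sum_of_nonneg fun i _ => hw0 i, htot, ENNReal.ofReal_one]
  refine ⟨⟨τ, hτ⟩, fun s hs => ?_⟩
  rw [hsum _ (by nlinarith [mul_nonneg hs hm.le])]
  simp only [ProbabilityMeasure.coe_mk, τ]
  rw [integral_finsetSum_measure fun i _ => (integrable_dirac (by simp)).smul_measure
    ENNReal.ofReal_ne_top]
  refine Finset.sum_congr rfl fun i _ => ?_
  rw [integral_smul_measure, integral_dirac, ENNReal.toReal_ofReal (hw0 i), smul_eq_mul]
  have h1 := hd0 i
  have h2 : 0 < (fpSeq n)⁻¹ + s * fpSeq n - β i := by nlinarith [mul_nonneg hs hm.le]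
  have h3 : 0 < (fpSeq n)⁻¹ - β i + s * fpSeq n := by linarith
  simp only [pt]
  rw [show (fpSeq n)⁻¹ + s * fpSeq n - β i = (fpSeq n)⁻¹ - β i + s * fpSeq n by ring]
  generalize (fpSeq n)⁻¹ - β i = d at h1 h3 ⊢
  field_simp

theorem continuous_inv_one_add_mul {s : ℝ} (hs : 0 ≤ s) :
    Continuous fun u : Icc (0 : ℝ) 1 => (1 + s * (u : ℝ))⁻¹ := by
  refine Continuous.inv₀ (by fun_prop) fun u => ?_
  have := mul_nonneg hs u.2.1
  positivity

theorem integrable_inv_one_add_mul (τ : Measure (Icc (0 : ℝ) 1)) [IsFiniteMeasure τ] {s : ℝ}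
    (hs : 0 ≤ s) : Integrable (fun u : Icc (0 : ℝ) 1 => (1 + s * (u : ℝ))⁻¹) τ :=
  (continuous_inv_one_add_mul hs).integrable_of_hasCompactSupport
    (HasCompactSupport.of_compactSpace _)

theorem exists_probabilityMeasure_fpSeq :
    ∃ τ : ProbabilityMeasure (Icc (0 : ℝ) 1), ∀ k : ℕ,
      ∫ u, (1 + (k : ℝ) * (u : ℝ))⁻¹ ∂(τ : Measure (Icc (0 : ℝ) 1)) = fpSeq k := by
  choose T hT using exists_probabilityMeasure_inv_iterate_subInv
  let U : Ultrafilter (ProbabilityMeasure (Icc (0 : ℝ) 1)) := (hyperfilter ℕ).map T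
  refine ⟨U.lim, fun k => ?_⟩
  have hlim : Tendsto T (hyperfilter ℕ) (𝓝 U.lim) := U.le_nhds_lim
  have hint := (ProbabilityMeasure.tendsto_iff_forall_integral_tendsto.1 hlim)
    (BoundedContinuousFunction.mkOfCompact ⟨_, continuous_inv_one_add_mul k.cast_nonneg⟩)
  simp only [BoundedContinuousFunction.mkOfCompact_apply, ContinuousMap.coe_mk,
    hT _ _ k.cast_nonneg] at hint
  exact tendsto_nhds_unique hint
    ((tendsto_inv_iterate_subInv k).mono_left Nat.hyperfilter_le_atTop)

theorem setIntegral_Icc_eq_of_moments_eq {μ ν : Measure ℝ} [IsFiniteMeasure μ]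
    [IsFiniteMeasure ν]
    (h : ∀ n : ℕ, ∫ t in Icc (0 : ℝ) 1, t ^ n ∂μ = ∫ t in Icc (0 : ℝ) 1, t ^ n ∂ν)
    {g : ℝ → ℝ} (hg : ContinuousOn g (Icc 0 1)) :
    ∫ t in Icc (0 : ℝ) 1, g t ∂μ = ∫ t in Icc (0 : ℝ) 1, g t ∂ν := by
  have hpoly : ∀ p : Polynomial ℝ,
      ∫ t in Icc (0 : ℝ) 1, p.eval t ∂μ = ∫ t in Icc (0 : ℝ) 1, p.eval t ∂ν := by
    intro p
    have hi : ∀ (ρ : Measure ℝ) [IsFiniteMeasure ρ] (i : ℕ),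
        Integrable (fun t => p.coeff i * t ^ i) (ρ.restrict (Icc 0 1)) := fun ρ _ i =>
      (Continuous.continuousOn (by fun_prop)).integrableOn_compact isCompact_Icc
    simp_rw [Polynomial.eval_eq_sum_range]
    rw [integral_finsetSum _ fun i _ => hi μ i, integral_finsetSum _ fun i _ => hi ν i]
    simp_rw [integral_const_mul, h]
  have happ : ∀ (ρ : Measure ℝ) [IsFiniteMeasure ρ] (p : Polynomial ℝ) (ε : ℝ),
      (∀ x ∈ Icc (0 : ℝ) 1, |p.eval x - g x| < ε) →
      |∫ t in Icc (0 : ℝ) 1, p.eval t ∂ρ - ∫ t in Icc (0 : ℝ) 1, g t ∂ρ| ≤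
        ε * ρ.real (Icc 0 1) := by
    intro ρ _ p ε hp
    rw [← integral_sub (p.continuous.continuousOn.integrableOn_compact isCompact_Icc)
      (hg.integrableOn_compact isCompact_Icc)]
    rw [← Real.norm_eq_abs]
    exact norm_setIntegral_le_of_norm_le_const (measure_lt_top _ _) fun x hx => (hp x hx).le
  rw [← sub_eq_zero, ← abs_nonpos_iff]
  set C := μ.real (Icc 0 1) + ν.real (Icc 0 1)
  have hC : 0 ≤ C := by positivity
  refine le_of_forall_pos_le_add fun ε hε => ?_
  obtain ⟨p, hp⟩ := exists_polynomial_near_of_continuousOn 0 1 g hg (ε / (C + 1)) (by positivity)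
  have h1 := happ μ p _ hp
  have h2 := happ ν p _ hp
  rw [hpoly p] at h1
  have h3 : ε / (C + 1) * C ≤ ε := by
    rw [div_mul_eq_mul_div, div_le_iff₀ (by positivity)]
    nlinarith
  rw [abs_le] at h1 h2 ⊢
  have h4 : ε / (C + 1) * C = ε / (C + 1) * μ.real (Icc 0 1) + ε / (C + 1) * ν.real (Icc 0 1) := by
    ring
  constructor <;> linarith [h1.1, h1.2, h2.1, h2.2]

theorem integral_Icc_rpow_rpow {u s : ℝ} (hu : 0 ≤ u) (hs : 0 ≤ s) :
    ∫ v in Icc (0 : ℝ) 1, (v ^ u) ^ s = (1 + s * u)⁻¹ := by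
  have hus : 0 ≤ u * s := mul_nonneg hu hs
  calc ∫ v in Icc (0 : ℝ) 1, (v ^ u) ^ s = ∫ v in Icc (0 : ℝ) 1, v ^ (u * s) :=
        setIntegral_congr_fun measurableSet_Icc fun v hv => (Real.rpow_mul hv.1 u s).symm
    _ = ∫ v in (0 : ℝ)..1, v ^ (u * s) := by
        rw [integral_Icc_eq_integral_Ioc, intervalIntegral.integral_of_le zero_le_one]
    _ = (1 + s * u)⁻¹ := by
        rw [integral_rpow (Or.inl (by linarith)), Real.one_rpow,
          Real.zero_rpow (by linarith), sub_zero, one_div, add_comm, mul_comm]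

/-- The law of `v ^ u` for `v` uniform on `[0, 1]` and `u` of law `τ` independent of `v`. -/
noncomputable def uniformPowLaw (τ : Measure (Icc (0 : ℝ) 1)) : Measure ℝ :=
  ((volume.restrict (Icc (0 : ℝ) 1)).prod τ).map fun z => z.1 ^ (z.2 : ℝ)

instance (τ : Measure (Icc (0 : ℝ) 1)) [IsFiniteMeasure τ] : IsFiniteMeasure (uniformPowLaw τ) := by
  unfold uniformPowLaw
  infer_instance

theorem setIntegral_rpow_uniformPowLaw (τ : Measure (Icc (0 : ℝ) 1)) [IsFiniteMeasure τ] {s : ℝ}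
    (hs : 0 ≤ s) :
    ∫ t in Icc (0 : ℝ) 1, t ^ s ∂uniformPowLaw τ = ∫ u, (1 + s * (u : ℝ))⁻¹ ∂τ := by
  have hmeas : Measurable fun z : ℝ × Icc (0 : ℝ) 1 => z.1 ^ (z.2 : ℝ) := by fun_prop
  have hfst : ∀ᵐ z ∂(volume.restrict (Icc (0 : ℝ) 1)).prod τ, z.1 ∈ Icc (0 : ℝ) 1 :=
    Measure.quasiMeasurePreserving_fst.ae (ae_restrict_mem measurableSet_Icc)
  have hmem : ∀ᵐ z ∂(volume.restrict (Icc (0 : ℝ) 1)).prod τ,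
      z.1 ^ (z.2 : ℝ) ∈ Icc (0 : ℝ) 1 := by
    filter_upwards [hfst] with z hz
    exact ⟨Real.rpow_nonneg hz.1 _, Real.rpow_le_one hz.1 hz.2 z.2.2.1⟩
  have hfull : ∀ᵐ t ∂uniformPowLaw τ, t ∈ Icc (0 : ℝ) 1 :=
    (ae_map_iff hmeas.aemeasurable measurableSet_Icc).2 hmem
  rw [Measure.restrict_eq_self_of_ae_mem hfull, uniformPowLaw,
    integral_map hmeas.aemeasurable (by fun_prop), integral_prod_symm]
  · exact integral_congr_ae (.of_forall fun u => integral_Icc_rpow_rpow u.2.1 hs)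
  · refine Integrable.of_bound (hmeas.pow_const s).aestronglyMeasurable 1 ?_
    filter_upwards [hmem] with z hz
    rw [Real.norm_of_nonneg (Real.rpow_nonneg hz.1 _)]
    exact Real.rpow_le_one hz.1 hz.2 hs

theorem setIntegral_rpow_eq_of_moments {μ : Measure ℝ} [IsFiniteMeasure μ]
    {τ : Measure (Icc (0 : ℝ) 1)} [IsFiniteMeasure τ]
    (h : ∀ n : ℕ, ∫ t in Icc (0 : ℝ) 1, t ^ n ∂μ = ∫ u, (1 + (n : ℝ) * (u : ℝ))⁻¹ ∂τ)
    {s : ℝ} (hs : 0 ≤ s) :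
    ∫ t in Icc (0 : ℝ) 1, t ^ s ∂μ = ∫ u, (1 + s * (u : ℝ))⁻¹ ∂τ := by
  rw [← setIntegral_rpow_uniformPowLaw τ hs]
  refine setIntegral_Icc_eq_of_moments_eq (fun n => ?_)
    (Real.continuous_rpow_const hs).continuousOn
  rw [h, ← setIntegral_rpow_uniformPowLaw τ n.cast_nonneg]
  simp_rw [Real.rpow_natCast]

theorem ae_ne_zero_of_tendsto_integral {τ : Measure (Icc (0 : ℝ) 1)} [IsFiniteMeasure τ]
    (h : Tendsto (fun n : ℕ => ∫ u, (1 + (n : ℝ) * (u : ℝ))⁻¹ ∂τ) atTop (𝓝 0)) :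
    ∀ᵐ u : Icc (0 : ℝ) 1 ∂τ, (u : ℝ) ≠ 0 := by
  set z : Icc (0 : ℝ) 1 := ⟨0, by simp⟩ with hz
  suffices τ {z} = 0 by
    filter_upwards [compl_mem_ae_iff.2 this] with u hu h0
    exact hu (Subtype.ext h0)
  rw [← measureReal_eq_zero_iff]
  refine le_antisymm (ge_of_tendsto' h fun n => ?_) measureReal_nonneg
  calc τ.real {z} = ∫ u in {z}, (1 + (n : ℝ) * (u : ℝ))⁻¹ ∂τ := by
        rw [integral_singleton]; simp [hz]
    _ ≤ ∫ u, (1 + (n : ℝ) * (u : ℝ))⁻¹ ∂τ := by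
        refine setIntegral_le_integral (integrable_inv_one_add_mul τ n.cast_nonneg)
          (.of_forall fun u => ?_)
        have := mul_nonneg (n.cast_nonneg (α := ℝ)) u.2.1
        simp only [Pi.zero_apply]
        positivity

theorem measure_singleton_one_eq_zero {μ : Measure ℝ} [IsFiniteMeasure μ]
    (h : Tendsto (fun n : ℕ => ∫ t in Icc (0 : ℝ) 1, t ^ n ∂μ) atTop (𝓝 0)) :
    μ {1} = 0 := by
  rw [← measureReal_eq_zero_iff]
  refine le_antisymm (ge_of_tendsto' h fun n => ?_) measureReal_nonneg
  calc μ.real {1} = ∫ t in {(1 : ℝ)}, t ^ n ∂μ := by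
        rw [integral_singleton]; simp
    _ ≤ ∫ t in Icc (0 : ℝ) 1, t ^ n ∂μ := by
        refine setIntegral_mono_set
          ((Continuous.continuousOn (by fun_prop)).integrableOn_compact isCompact_Icc) ?_ ?_
        · filter_upwards [ae_restrict_mem measurableSet_Icc] with t ht
          exact pow_nonneg ht.1 n
        · exact (singleton_subset_iff.2 (by simp)).eventuallyLE

/-- The image under `h` of the measure with density `g`. -/
noncomputable def densityImage (τ : Measure (Icc (0 : ℝ) 1)) (g h : Icc (0 : ℝ) 1 → ℝ) :
    Measure ℝ :=
  (τ.withDensity fun u => ENNReal.ofReal (g u)).map h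

theorem densityImage_Iio {τ : Measure (Icc (0 : ℝ) 1)} {g h : Icc (0 : ℝ) 1 → ℝ}
    (hm : Measurable h) (h0 : ∀ u, 0 ≤ h u) : densityImage τ g h (Iio 0) = 0 := by
  have hempty : h ⁻¹' Iio 0 = ∅ := by
    ext u
    simpa using h0 u
  rw [densityImage, Measure.map_apply hm measurableSet_Iio, hempty, measure_empty]

theorem lintegral_densityImage {τ : Measure (Icc (0 : ℝ) 1)} {g h : Icc (0 : ℝ) 1 → ℝ}
    (hgm : Measurable g) (hm : Measurable h) (hg : ∀ u, 0 ≤ g u) (s : ℝ) :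
    ∫⁻ x, ENNReal.ofReal (x + s)⁻¹ ∂densityImage τ g h =
      ∫⁻ u, ENNReal.ofReal (g u * (h u + s)⁻¹) ∂τ := by
  rw [densityImage, lintegral_map (by fun_prop) hm,
    lintegral_withDensity_eq_lintegral_mul _ (by fun_prop) (by fun_prop)]
  simp [ENNReal.ofReal_mul (hg _)]

theorem setIntegral_Ici_inv_add {ρ : Measure ℝ} (hρ : ρ (Iio 0) = 0) {s : ℝ} (hs : 0 < s) :
    ∫ x in Ici (0 : ℝ), (x + s)⁻¹ ∂ρ = (∫⁻ x, ENNReal.ofReal (x + s)⁻¹ ∂ρ).toReal := by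
  have hmem : ∀ᵐ x ∂ρ, x ∈ Ici (0 : ℝ) := by
    rwa [← compl_Ici] at hρ
  rw [Measure.restrict_eq_self_of_ae_mem hmem, integral_eq_lintegral_of_nonneg_ae _ (by fun_prop)]
  filter_upwards [hmem] with x hx
  have hx : 0 ≤ x := hx
  simp only [Pi.zero_apply]
  positivity

theorem ofReal_bernKernelReal {s t : ℝ} (hs : 0 < s) (ht0 : 0 ≤ t) (ht1 : t < 1) :
    ENNReal.ofReal (bernKernelReal s t) = ∑' n : ℕ, ENNReal.ofReal (t ^ n - t ^ (n + s)) := by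
  have hts : 0 ≤ 1 - t ^ s := sub_nonneg.2 (Real.rpow_le_one ht0 ht1.le hs.le)
  have hterm : ∀ n : ℕ, t ^ n - t ^ (n + s) = t ^ n * (1 - t ^ s) := fun n => by
    rw [Real.rpow_add_of_nonneg ht0 n.cast_nonneg hs.le, Real.rpow_natCast]
    ring
  have hsum := (hasSum_geometric_of_lt_one ht0 ht1).mul_right (1 - t ^ s)
  simp_rw [hterm]
  rw [← ENNReal.ofReal_tsum_of_nonneg (fun n => mul_nonneg (pow_nonneg ht0 n) hts) hsum.summable,
    hsum.tsum_eq, bernKernelReal, if_neg ht1.ne, div_eq_mul_inv, mul_comm]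

theorem bernKernelReal_nonneg {s t : ℝ} (hs : 0 < s) (ht : t ∈ Icc (0 : ℝ) 1) :
    0 ≤ bernKernelReal s t := by
  unfold bernKernelReal
  split_ifs
  · exact hs.le
  · exact div_nonneg (sub_nonneg.2 (Real.rpow_le_one ht.1 ht.2 hs.le)) (sub_nonneg.2 ht.2)

theorem measurable_bernKernelReal (s : ℝ) : Measurable (bernKernelReal s) :=
  Measurable.ite (measurableSet_singleton 1) measurable_const (by fun_prop)

theorem lintegral_bernKernelReal {μ : Measure ℝ} [IsFiniteMeasure μ] (h1 : μ {1} = 0) {s : ℝ}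
    (hs : 0 < s) :
    ∫⁻ t in Icc (0 : ℝ) 1, ENNReal.ofReal (bernKernelReal s t) ∂μ =
      ∑' n : ℕ, ENNReal.ofReal ((∫ t in Icc (0 : ℝ) 1, t ^ n ∂μ) -
        ∫ t in Icc (0 : ℝ) 1, t ^ (n + s) ∂μ) := by
  have hne : ∀ᵐ t ∂μ.restrict (Icc 0 1), t ≠ 1 :=
    ae_restrict_of_ae (compl_mem_ae_iff.2 h1)
  have hmem := ae_restrict_mem (μ := μ) (measurableSet_Icc (a := (0 : ℝ)) (b := 1))
  calc ∫⁻ t in Icc (0 : ℝ) 1, ENNReal.ofReal (bernKernelReal s t) ∂μ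
      = ∫⁻ t in Icc (0 : ℝ) 1, ∑' n : ℕ, ENNReal.ofReal (t ^ n - t ^ (n + s)) ∂μ := by
        refine lintegral_congr_ae ?_
        filter_upwards [hne, hmem] with t ht1 ht
        exact ofReal_bernKernelReal hs ht.1 (lt_of_le_of_ne ht.2 ht1)
    _ = ∑' n : ℕ, ∫⁻ t in Icc (0 : ℝ) 1, ENNReal.ofReal (t ^ n - t ^ (n + s)) ∂μ :=
        lintegral_tsum fun n => by fun_prop
    _ = _ := by
        congr 1 with n
        have hns : 0 ≤ (n : ℝ) + s := by positivity
        have hi1 : IntegrableOn (fun t : ℝ => t ^ n) (Icc 0 1) μ :=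
          (continuous_pow n).continuousOn.integrableOn_compact isCompact_Icc
        have hi2 : IntegrableOn (fun t : ℝ => t ^ (n + s)) (Icc 0 1) μ :=
          (Real.continuous_rpow_const hns).continuousOn.integrableOn_compact isCompact_Icc
        have hi : IntegrableOn (fun t : ℝ => t ^ n - t ^ (n + s)) (Icc 0 1) μ := hi1.sub hi2
        rw [← integral_sub hi1 hi2, ofReal_integral_eq_lintegral_ofReal hi]
        filter_upwards [hmem] with t ht
        rw [Pi.zero_apply, sub_nonneg, ← Real.rpow_natCast]
        exact Real.rpow_le_rpow_of_exponent_ge_of_imp ht.1 ht.2 (by linarith)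
          fun _ h => by linarith

theorem stieltjes_representation {μ : Measure ℝ} [IsFiniteMeasure μ]
    {τ : Measure (Icc (0 : ℝ) 1)} [IsFiniteMeasure τ]
    (hμ : ∀ n : ℕ, ∫ t in Icc (0 : ℝ) 1, t ^ n ∂μ = ∫ u, (1 + (n : ℝ) * (u : ℝ))⁻¹ ∂τ)
    (hlim : Tendsto (fun n : ℕ => ∫ t in Icc (0 : ℝ) 1, t ^ n ∂μ) atTop (𝓝 0)) :
    ∃ σ σ' : Measure ℝ, σ (Set.Iio (0:ℝ)) = 0 ∧ σ' (Set.Iio (0:ℝ)) = 0 ∧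
      ∀ s : ℝ, 0 < s →
        (∫ t in Set.Icc (0:ℝ) 1, t ^ s ∂μ) =
          (∫ x in Set.Ici (0:ℝ), (x + s)⁻¹ ∂σ) ∧
        bernTransformReal μ s / s = ∫ x in Set.Ici (0:ℝ), (x + s)⁻¹ ∂σ' := by
  have hne : ∀ᵐ u : Icc (0 : ℝ) 1 ∂τ, (u : ℝ) ≠ 0 :=
    ae_ne_zero_of_tendsto_integral (by simpa only [hμ] using hlim)
  have hpos : ∀ (s : ℝ) (u : Icc (0 : ℝ) 1), 0 ≤ s → 0 < 1 + s * (u : ℝ) := fun s u hs => by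
    have := mul_nonneg hs u.2.1
    positivity
  have hinv : ∀ u : Icc (0 : ℝ) 1, 0 ≤ (u : ℝ)⁻¹ := fun u => inv_nonneg.2 u.2.1
  have hσ : densityImage τ (fun u => (u : ℝ)⁻¹) (fun u => (u : ℝ)⁻¹) (Iio 0) = 0 :=
    densityImage_Iio (by fun_prop) hinv
  let ρ : ℕ → Measure ℝ := fun n =>
    densityImage τ (fun u => (1 + (n : ℝ) * (u : ℝ))⁻¹) fun u => (u : ℝ)⁻¹ + n
  have hσ' : Measure.sum ρ (Iio 0) = 0 := by
    rw [Measure.sum_apply _ measurableSet_Iio, ENNReal.tsum_eq_zero]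
    exact fun n => densityImage_Iio (by fun_prop) fun u => add_nonneg (hinv u) n.cast_nonneg
  refine ⟨_, _, hσ, hσ', fun s hs => ⟨?_, ?_⟩⟩
  · rw [setIntegral_Ici_inv_add hσ hs, lintegral_densityImage (by fun_prop) (by fun_prop) hinv,
      setIntegral_rpow_eq_of_moments hμ hs.le, integral_eq_lintegral_of_nonneg_ae
        (.of_forall fun u => (inv_pos.2 (hpos s u hs.le)).le)
        (integrable_inv_one_add_mul τ hs.le).aestronglyMeasurable]
    congr 1
    refine lintegral_congr_ae ?_
    filter_upwards [hne] with u hu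
    rw [← mul_inv, mul_add, mul_inv_cancel₀ hu, mul_comm s]
  · rw [setIntegral_Ici_inv_add hσ' hs, lintegral_sum_measure, bernTransformReal,
      integral_eq_lintegral_of_nonneg_ae
        ((ae_restrict_mem measurableSet_Icc).mono fun t ht => bernKernelReal_nonneg hs ht)
        (measurable_bernKernelReal s).aestronglyMeasurable,
      lintegral_bernKernelReal (measure_singleton_one_eq_zero hlim) hs, div_eq_iff hs.ne']
    nth_rewrite 3 [← ENNReal.toReal_ofReal hs.le]
    rw [← ENNReal.toReal_mul, ← ENNReal.tsum_mul_right]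
    congr 2 with n
    have hns : 0 ≤ (n : ℝ) + s := by positivity
    have hi1 := integrable_inv_one_add_mul τ (n.cast_nonneg (α := ℝ))
    have hi2 := integrable_inv_one_add_mul τ hns
    have hi : Integrable (fun u : Icc (0 : ℝ) 1 =>
        (1 + (n : ℝ) * (u : ℝ))⁻¹ - (1 + (n + s) * (u : ℝ))⁻¹) τ := hi1.sub hi2
    rw [hμ, setIntegral_rpow_eq_of_moments hμ hns, ← integral_sub hi1 hi2,
      lintegral_densityImage (by fun_prop) (by fun_prop)
        fun u => (inv_pos.2 (hpos n u n.cast_nonneg)).le,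
      ← lintegral_mul_const _ (by fun_prop),
      ofReal_integral_eq_lintegral_ofReal hi]
    · refine lintegral_congr_ae ?_
      filter_upwards [hne] with u hu
      have hu0 : 0 < (u : ℝ) := lt_of_le_of_ne u.2.1 hu.symm
      have h1 := hpos n u n.cast_nonneg
      have h2 := hpos _ u hns
      rw [← ENNReal.ofReal_mul' hs.le]
      congr 1
      have h3 : (u : ℝ)⁻¹ + n + s = (1 + (n + s) * u) / u := by
        field_simp
        ring
      rw [h3]
      field_simp
      ring
    · refine .of_forall fun u => ?_
      rw [Pi.zero_apply, sub_nonneg]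
      have h1 := hpos n u n.cast_nonneg
      have := u.2.1
      gcongr
      linarith

theorem stmt_15 (μ : Measure ℝ) [IsProbabilityMeasure μ]
    (hsupp : μ (Set.Icc (0:ℝ) 1)ᶜ = 0) (h0 : μ {0} = 0)
    (hmom : ∀ n : ℕ, ∫ t in Set.Icc (0:ℝ) 1, t ^ n ∂μ = fpSeq n) :
    ∃ σ σ' : Measure ℝ, σ (Set.Iio (0:ℝ)) = 0 ∧ σ' (Set.Iio (0:ℝ)) = 0 ∧
      ∀ s : ℝ, 0 < s →
        (∫ t in Set.Icc (0:ℝ) 1, t ^ s ∂μ) =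
          (∫ x in Set.Ici (0:ℝ), (x + s)⁻¹ ∂σ) ∧
        bernTransformReal μ s / s = ∫ x in Set.Ici (0:ℝ), (x + s)⁻¹ ∂σ' := by
  obtain ⟨τ, hτ⟩ := exists_probabilityMeasure_fpSeq
  exact stieltjes_representation (fun n => (hmom n).trans (hτ n).symm)
    (tendsto_fpSeq.congr fun n => (hmom n).symm)
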